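/- Let F be a finite field, let C1 ⊆ C2 ⊆ (Fin n → F) be nested linear codes such that every nonzero c ∈ C1 has Hamming weight ≥ d1 and every nonzero c ∈ C2 has Hamming weight ≥ d2, and let f : C2 →ₗ[F] (Fin n3 → F) be a linear map such that f c = 0 if and only if c ∈ C1, and such that every nonzero vector in the range of f has Hamming weight ≥ d3. Then there exists a linear code D ⊆ (Fin (n + n3) → F) with dim D = dim C2 such that every nonzero codeword of D has Hamming weight ≥ min(d1, d2 + d3); explicitly, one can take D = {(c, f c) : c ∈ C2} (juxtaposing the n coordinates of c with the n3 coordinates of f c). -/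

import Mathlib

open scoped BigOperators

noncomputable section

variable {F : Type*} [Field F] [Fintype F] [DecidableEq F]

/-- The Hamming weight of a vector. -/
def wgt {n : ℕ} (c : Fin n → F) : ℕ :=
  (Finset.univ.filter (fun i : Fin n => c i ≠ 0)).card

theorem wgt_append {m n : ℕ} (a : Fin m → F) (b : Fin n → F) :
    wgt (Fin.append a b) = wgt a + wgt b := by
  simp only [wgt, Finset.card_filter, Fin.sum_univ_add, Fin.append_left, Fin.append_right]

/-- The linear map `c ↦ (c, f c)`, with values in the juxtaposed coordinates. -/
def juxtapose {n m : ℕ} (C : Submodule F (Fin n → F)) (f : C →ₗ[F] (Fin m → F)) :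
    C →ₗ[F] (Fin (n + m) → F) where
  toFun c := Fin.append (c : Fin n → F) (f c)
  map_add' x y := by
    ext i
    refine Fin.addCases (fun i => ?_) (fun i => ?_) i <;> simp
  map_smul' r x := by
    ext i
    refine Fin.addCases (fun i => ?_) (fun i => ?_) i <;> simp

theorem juxtapose_injective {n m : ℕ} (C : Submodule F (Fin n → F))
    (f : C →ₗ[F] (Fin m → F)) : Function.Injective (juxtapose C f) := by
  intro x y h
  ext i
  simpa [juxtapose] using congrFun h (Fin.castAdd m i)

/-- Classical Construction X: given nested linear codes `C1 ⊆ C2` with distances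
`d1`, `d2` and a linear map `f : C2 → (Fin n3 → F)` with kernel exactly `C1`
whose nonzero image vectors have weight `≥ d3`, the juxtaposed code
`D = {(c, f c) : c ∈ C2}` has the same dimension as `C2` and distance
`≥ min(d1, d2 + d3)`. -/
theorem classical_constructionX
    {n n3 d1 d2 d3 : ℕ}
    (C1 C2 : Submodule F (Fin n → F)) (hnested : C1 ≤ C2)
    (hd1 : ∀ c ∈ C1, c ≠ 0 → d1 ≤ wgt c)
    (hd2 : ∀ c ∈ C2, c ≠ 0 → d2 ≤ wgt c)
    (f : C2 →ₗ[F] (Fin n3 → F))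
    (hker : ∀ c : C2, f c = 0 ↔ (c : Fin n → F) ∈ C1)
    (hd3 : ∀ c : C2, f c ≠ 0 → d3 ≤ wgt (f c)) :
    ∃ D : Submodule F (Fin (n + n3) → F),
      Module.finrank F D = Module.finrank F C2 ∧
      (∀ v ∈ D, v ≠ 0 → min d1 (d2 + d3) ≤ wgt v) ∧
      (∀ v, v ∈ D ↔ ∃ c : C2, v = Fin.append (c : Fin n → F) (f c)) := by
  refine ⟨LinearMap.range (juxtapose C2 f),
    LinearMap.finrank_range_of_inj (juxtapose_injective C2 f), ?_, fun v => ?_⟩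
  · rintro _ ⟨c, rfl⟩ hv
    have hc : (c : Fin n → F) ≠ 0 := by
      intro h
      have h_zero : c = 0 := Subtype.ext h
      exact hv (by rw [h_zero, map_zero])
    change min d1 (d2 + d3) ≤ wgt (Fin.append (c : Fin n → F) (f c))
    rw [wgt_append]
    by_cases hf : f c = 0
    · have := hd1 c ((hker c).1 hf) hc
      omega
    · have := hd2 c c.2 hc
      have := hd3 c hf
      omega
  · exact ⟨fun ⟨c, hc⟩ => ⟨c, hc.symm⟩, fun ⟨c, hc⟩ => ⟨c, hc.symm⟩⟩

end
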